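/- arXiv:1201.5241 — 2 statements merged into one kernel-verified Lean document; each statement's English description precedes it below -/
import Mathlib

section
/- If a rank function g is s-representable, then g ∈ W̄(Υ_{s,n}), i.e. g lies in the closure of the set {c·g' : c > 0, g' ∈ Υ_{s,n}}. -/
open MeasureTheory

noncomputable section

/-- The principal submatrix of `K` with rows and columns indexed by `α`. -/
def principalSub {n : ℕ} (K : Matrix (Fin n) (Fin n) ℝ) (α : Finset (Fin n)) :
    Matrix {i // i ∈ α} {i // i ∈ α} ℝ :=
  K.submatrix (fun i => i.1) (fun i => i.1)

/-- A closed convex cone: a closed convex set stable under positive scaling. -/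
def IsClosedConvexCone {E : Type*} [AddCommMonoid E] [Module ℝ E] [TopologicalSpace E]
    (C : Set E) : Prop :=
  IsClosed C ∧ Convex ℝ C ∧ ∀ c : ℝ, 0 < c → ∀ x ∈ C, c • x ∈ C

/-- `ccc S` is the smallest closed convex cone containing `S`. -/
def ccc {E : Type*} [AddCommMonoid E] [Module ℝ E] [TopologicalSpace E] (S : Set E) : Set E :=
  ⋂₀ {C : Set E | IsClosedConvexCone C ∧ S ⊆ C}

/-- `Wscale S` is the set of positive scalar multiples of elements of `S`. -/
def Wscale {E : Type*} [SMul ℝ E] (S : Set E) : Set E :=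
  {h | ∃ c : ℝ, 0 < c ∧ ∃ g ∈ S, h = c • g}

/-- The rank function `φⁿᵢ`. -/
def phiFn (n : ℕ) (i : Fin n) : Finset (Fin n) → ℝ :=
  fun α => if i ∈ α then -1 else 0

/-- s-Gaussian rank functions: differential entropy functions of `n` jointly Gaussian
scalar random variables with positive definite covariance matrix. -/
def IsSGaussian (n : ℕ) (g : Finset (Fin n) → ℝ) : Prop :=
  ∃ K : Matrix (Fin n) (Fin n) ℝ, K.PosDef ∧
    ∀ α : Finset (Fin n),
      g α = 1 / 2 * Real.logb 2
        ((2 * Real.pi * Real.exp 1) ^ α.card * (principalSub K α).det)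

/-- The principal submatrix on the blocks indexed by `α`. -/
def vPrincipal {n : ℕ} {k : Fin n → ℕ}
    (K : Matrix ((i : Fin n) × Fin (k i)) ((i : Fin n) × Fin (k i)) ℝ)
    (α : Finset (Fin n)) :
    Matrix {p : (i : Fin n) × Fin (k i) // p.1 ∈ α}
      {p : (i : Fin n) × Fin (k i) // p.1 ∈ α} ℝ :=
  K.submatrix (fun p => p.1) (fun p => p.1)

/-- v-Gaussian rank functions: differential entropy functions of `n` jointly Gaussian
random vectors of positive lengths `k i`, with positive definite joint covariance. -/
def IsVGaussian (n : ℕ) (g : Finset (Fin n) → ℝ) : Prop :=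
  ∃ k : Fin n → ℕ, (∀ i, 0 < k i) ∧
    ∃ K : Matrix ((i : Fin n) × Fin (k i)) ((i : Fin n) × Fin (k i)) ℝ, K.PosDef ∧
      ∀ α : Finset (Fin n),
        g α = 1 / 2 * Real.logb 2
          ((2 * Real.pi * Real.exp 1) ^ (∑ i ∈ α, k i) * (vPrincipal K α).det)

/-- Normalised Gaussian entropy functions: all blocks have common length `T`, and the
entropy function is multiplied by `1/T`. -/
def IsNormGaussian (n : ℕ) (g : Finset (Fin n) → ℝ) : Prop :=
  ∃ T : ℕ, 0 < T ∧
    ∃ K : Matrix (Fin n × Fin T) (Fin n × Fin T) ℝ, K.PosDef ∧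
      ∀ α : Finset (Fin n),
        g α = (1 / (T : ℝ)) * (1 / 2 * Real.logb 2
          ((2 * Real.pi * Real.exp 1) ^ (T * α.card) *
            (K.submatrix (fun p : {p : Fin n × Fin T // p.1 ∈ α} => p.1)
              (fun p => p.1)).det))

/-- `g` is the differential entropy function of scalar random variables `X`:
the joint law has a density, every nonempty subtuple has a density whose entropy
integrand is integrable, `g ∅ = 0`, and `g α = h(X_α)` (base-2). -/
def SEntropyData (n : ℕ) (Ω : Type) [MeasureSpace Ω] (X : Fin n → Ω → ℝ)
    (g : Finset (Fin n) → ℝ) : Prop :=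
  IsProbabilityMeasure (volume : Measure Ω) ∧
  Measurable (fun ω i => X i ω) ∧
  (∃ f : (Fin n → ℝ) → ℝ, Measurable f ∧ (∀ x, 0 ≤ f x) ∧
    Measure.map (fun ω i => X i ω) volume
      = volume.withDensity fun x => ENNReal.ofReal (f x)) ∧
  g ∅ = 0 ∧
  ∀ α : Finset (Fin n), α.Nonempty →
    ∃ f : ({i // i ∈ α} → ℝ) → ℝ, Measurable f ∧ (∀ x, 0 ≤ f x) ∧
      Measure.map (fun ω (i : {i // i ∈ α}) => X i.1 ω) volume
        = volume.withDensity (fun x => ENNReal.ofReal (f x)) ∧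
      Integrable (fun x => f x * Real.logb 2 (f x)) ∧
      g α = -∫ x, f x * Real.logb 2 (f x)

/-- s-entropic rank functions. -/
def IsSEntropic (n : ℕ) (g : Finset (Fin n) → ℝ) : Prop :=
  ∃ (Ω : Type) (m : MeasureSpace Ω) (X : Fin n → Ω → ℝ), @SEntropyData n Ω m X g

/-- `g` is the differential entropy function of random vectors `X i : Ω → ℝ^{k i}`. -/
def VEntropyData (n : ℕ) (k : Fin n → ℕ) (Ω : Type) [MeasureSpace Ω]
    (X : (i : Fin n) → Ω → (Fin (k i) → ℝ)) (g : Finset (Fin n) → ℝ) : Prop :=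
  IsProbabilityMeasure (volume : Measure Ω) ∧
  Measurable (fun ω (i : Fin n) => X i ω) ∧
  (∃ f : ((i : Fin n) → Fin (k i) → ℝ) → ℝ, Measurable f ∧ (∀ x, 0 ≤ f x) ∧
    Measure.map (fun ω (i : Fin n) => X i ω) volume
      = volume.withDensity fun x => ENNReal.ofReal (f x)) ∧
  g ∅ = 0 ∧
  ∀ α : Finset (Fin n), α.Nonempty →
    ∃ f : ((i : {i // i ∈ α}) → Fin (k i.1) → ℝ) → ℝ, Measurable f ∧ (∀ x, 0 ≤ f x) ∧
      Measure.map (fun ω (i : {i // i ∈ α}) => X i.1 ω) volume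
        = volume.withDensity (fun x => ENNReal.ofReal (f x)) ∧
      Integrable (fun x => f x * Real.logb 2 (f x)) ∧
      g α = -∫ x, f x * Real.logb 2 (f x)

/-- v-entropic rank functions. -/
def IsVEntropic (n : ℕ) (g : Finset (Fin n) → ℝ) : Prop :=
  ∃ k : Fin n → ℕ, (∀ i, 0 < k i) ∧
    ∃ (Ω : Type) (m : MeasureSpace Ω) (X : (i : Fin n) → Ω → (Fin (k i) → ℝ)),
      @VEntropyData n k Ω m X g

/-- s-representable rank functions. -/
def IsSRepresentable (n : ℕ) (g : Finset (Fin n) → ℝ) : Prop :=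
  ∃ (k : ℕ) (A : Fin n → Fin k → ℝ),
    ∀ α : Finset (Fin n),
      g α = (Module.finrank ℝ ↥(Submodule.span ℝ (A '' (α : Set (Fin n)))) : ℝ)

/-- v-representable rank functions. -/
def IsVRepresentable (n : ℕ) (g : Finset (Fin n) → ℝ) : Prop :=
  ∃ (d : ℕ) (k : Fin n → ℕ) (A : (i : Fin n) → Fin (k i) → (Fin d → ℝ)),
    ∀ α : Finset (Fin n),
      g α = (Module.finrank ℝ
        ↥(Submodule.span ℝ {v : Fin d → ℝ | ∃ i ∈ α, ∃ j, v = A i j}) : ℝ)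

/-- The marginal probability mass function of a joint pmf `p` on the coordinates in `α`. -/
def marginalPMF {n : ℕ} (S : Fin n → ℕ) (p : ((i : Fin n) → Fin (S i)) → ℝ)
    (α : Finset (Fin n)) (x : (i : {i // i ∈ α}) → Fin (S i.1)) : ℝ :=
  ∑ y : (i : Fin n) → Fin (S i), if ∀ i : {i // i ∈ α}, y i.1 = x i then p y else 0

/-- The Shannon entropy (base 2) of the subtuple indexed by `α`. -/
def discEntropyFn {n : ℕ} (S : Fin n → ℕ) (p : ((i : Fin n) → Fin (S i)) → ℝ)
    (α : Finset (Fin n)) : ℝ :=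
  -∑ x : (i : {i // i ∈ α}) → Fin (S i.1),
    marginalPMF S p α x * Real.logb 2 (marginalPMF S p α x)

/-- Entropic rank functions: Shannon entropy functions of finitely-valued
discrete random variables. -/
def IsEntropic (n : ℕ) (g : Finset (Fin n) → ℝ) : Prop :=
  ∃ (S : Fin n → ℕ) (p : ((i : Fin n) → Fin (S i)) → ℝ),
    (∀ x, 0 ≤ p x) ∧ (∑ x, p x = 1) ∧ ∀ α, g α = discEntropyFn S p α

/-- The Ingleton inequality for a rank function on four variables. -/
def IngletonIneq (g : Finset (Fin 4) → ℝ) (i j k l : Fin 4) : Prop :=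
  g {i} + g {j} + g {k, l} + g {i, j, k} + g {i, j, l} ≤
    g {i, j} + g {i, k} + g {i, l} + g {j, k} + g {j, l}

open Filter Topology in
lemma tendsto_log_one_add_mul_div_log {c : ℝ} (hc : 0 ≤ c) :
    Tendsto (fun t : ℝ => Real.log (1 + t * c) / Real.log t) atTop
      (𝓝 (if c ≠ 0 then 1 else 0)) := by
  split_ifs with h
  · have hc' : 0 < c := lt_of_le_of_ne hc (Ne.symm h)
    have hlog : Tendsto (fun t : ℝ => Real.log (t⁻¹ + c)) atTop (𝓝 (Real.log (0 + c))) :=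
      (tendsto_inv_atTop_zero.add_const c).log (by simpa using h)
    have hlim := (hlog.div_atTop Real.tendsto_log_atTop).const_add 1
    rw [add_zero] at hlim
    refine hlim.congr' ?_
    filter_upwards [eventually_gt_atTop 1] with t ht
    have ht0 : 0 < t := one_pos.trans ht
    have hlt : Real.log t ≠ 0 := (Real.log_pos ht).ne'
    have hfac : 1 + t * c = t * (t⁻¹ + c) := by field_simp
    rw [hfac, Real.log_mul ht0.ne' (by positivity)]
    field_simp
  · simp only [ne_eq, not_not] at h
    simp [h]

lemma Matrix.IsHermitian.det_one_add_smul {m : Type*} [Fintype m] [DecidableEq m]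
    {M : Matrix m m ℝ} (hM : M.IsHermitian) {t : ℝ} (ht : t ≠ 0) :
    (1 + t • M).det = ∏ i, (1 + t * hM.eigenvalues i) := by
  have hfac : 1 + t • M = (-t) • (Matrix.scalar m (-t⁻¹) - M) := by
    ext i j
    by_cases hij : i = j
    · simp [hij]
      field_simp
      ring
    · simp [hij]
  rw [hfac, Matrix.det_smul, ← Matrix.eval_charpoly, hM.charpoly_eq, Polynomial.eval_prod,
    ← Finset.card_univ, ← Finset.prod_const, ← Finset.prod_mul_distrib]
  refine Finset.prod_congr rfl fun i _ => ?_
  simp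
  field_simp
  ring

open Filter Topology in
/-- The logarithm of `det (1 + t M)` grows like `rank M * log t`. -/
lemma Matrix.PosSemidef.tendsto_log_det_one_add_smul_div_log {m : Type*} [Fintype m]
    [DecidableEq m] {M : Matrix m m ℝ} (hM : M.PosSemidef) {b : ℝ} (hb : 0 < b) :
    Tendsto (fun t : ℝ => Real.log (b * (1 + t • M).det) / Real.log t) atTop
      (𝓝 (M.rank : ℝ)) := by
  have hrank : (M.rank : ℝ) = 0 + ∑ i, if hM.1.eigenvalues i ≠ 0 then (1 : ℝ) else 0 := by
    rw [hM.1.rank_eq_card_non_zero_eigs, Fintype.card_subtype, Finset.sum_boole, zero_add]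
  rw [hrank]
  have hconst : Tendsto (fun t : ℝ => Real.log b / Real.log t) atTop (𝓝 0) :=
    tendsto_const_nhds.div_atTop Real.tendsto_log_atTop
  refine (hconst.add (tendsto_finsetSum Finset.univ fun i _ =>
    tendsto_log_one_add_mul_div_log (hM.eigenvalues_nonneg i))).congr' ?_
  filter_upwards [eventually_gt_atTop 0] with t ht
  have hpos : ∀ i, 0 < 1 + t * hM.1.eigenvalues i := fun i =>
    add_pos_of_pos_of_nonneg one_pos (mul_nonneg ht.le (hM.eigenvalues_nonneg i))
  rw [hM.1.det_one_add_smul ht.ne', Real.log_mul hb.ne' (Finset.prod_pos fun i _ => hpos i).ne',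
    Real.log_prod fun i _ => (hpos i).ne', add_div, Finset.sum_div]

lemma rank_principalSub_self_mul_conjTranspose {n k : ℕ} (A : Matrix (Fin n) (Fin k) ℝ)
    (α : Finset (Fin n)) :
    (principalSub (A * A.conjTranspose) α).rank =
      Module.finrank ℝ (Submodule.span ℝ (A '' (α : Set (Fin n)))) := by
  let B : Matrix {i // i ∈ α} (Fin k) ℝ := A.submatrix (fun i => i.1) id
  have hgram : principalSub (A * A.conjTranspose) α = B * B.transpose := by
    ext i j
    simp [principalSub, B, Matrix.mul_apply]
  have hrow : Set.range B.row = A '' (α : Set (Fin n)) := by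
    ext v
    constructor
    · rintro ⟨i, rfl⟩
      exact ⟨i.1, i.2, rfl⟩
    · rintro ⟨i, hi, rfl⟩
      exact ⟨⟨i, hi⟩, rfl⟩
  rw [hgram, Matrix.rank_self_mul_transpose, Matrix.rank_eq_finrank_span_row, hrow]

lemma principalSub_one_add_smul {n : ℕ} (M : Matrix (Fin n) (Fin n) ℝ) (t : ℝ)
    (α : Finset (Fin n)) :
    principalSub (1 + t • M) α = 1 + t • principalSub M α := by
  ext i j
  simp only [principalSub, Matrix.submatrix_apply, Matrix.add_apply, Matrix.smul_apply,
    Matrix.one_apply, Subtype.ext_iff]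

/-- every s-representable rank function lies in `W̄(Υ_{s,n})`, the closure
of the set of positive scalar multiples of s-Gaussian functions. -/
theorem stmt4 (n : ℕ) (g : Finset (Fin n) → ℝ) (hg : IsSRepresentable n g) :
    g ∈ closure (Wscale {g' : Finset (Fin n) → ℝ | IsSGaussian n g'}) := by
  obtain ⟨k, A, hA⟩ := hg
  let G : Matrix (Fin n) (Fin n) ℝ := Matrix.of A * (Matrix.of A).conjTranspose
  have hG : G.PosSemidef := Matrix.posSemidef_self_mul_conjTranspose _
  let b : ℝ := 2 * Real.pi * Real.exp 1
  have hb : 0 < b := by positivity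
  refine mem_closure_of_tendsto (b := Filter.atTop)
    (f := fun (t : ℝ) (α : Finset (Fin n)) =>
      Real.log (b ^ α.card * (principalSub (1 + t • G) α).det) / Real.log t) ?_ ?_
  · refine tendsto_pi_nhds.2 fun α => ?_
    rw [hA α]
    have hrank := rank_principalSub_self_mul_conjTranspose (Matrix.of A) α
    simp only [principalSub_one_add_smul]
    have hlim := (show (principalSub G α).PosSemidef from
      hG.submatrix _).tendsto_log_det_one_add_smul_div_log (pow_pos hb α.card)
    rw [hrank] at hlim
    exact hlim
  · filter_upwards [Filter.eventually_gt_atTop 1] with t ht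
    have hlog := Real.log_pos ht
    have hlog2 : 0 < Real.log 2 := Real.log_pos one_lt_two
    refine ⟨2 * Real.log 2 / Real.log t, by positivity, _,
      ⟨1 + t • G, Matrix.PosDef.one.add_posSemidef (hG.smul (by positivity)), fun _ => rfl⟩, ?_⟩
    funext α
    simp only [Pi.smul_apply, smul_eq_mul, Real.logb]
    change Real.log (b ^ α.card * _) / _ = _ * (1 / 2 * (Real.log (b ^ α.card * _) / _))
    field_simp

end
end

section
/- The closure of the set of positive scalar multiples of v-Gaussian functions equals the closed convex cone generated by the v-Gaussian functions: W̄(Υ_{v,n}) = con(Υ_{v,n}). -/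
open MeasureTheory

noncomputable section

theorem Matrix.PosDef.fromBlocks_zero {m p : Type*} [Fintype m] [Fintype p]
    {A : Matrix m m ℝ} {D : Matrix p p ℝ} (hA : A.PosDef) (hD : D.PosDef) :
    (Matrix.fromBlocks A 0 0 D).PosDef := by
  rw [Matrix.posDef_iff_dotProduct_mulVec]
  refine ⟨Matrix.IsHermitian.fromBlocks hA.isHermitian (by simp) hD.isHermitian, fun x hx => ?_⟩
  obtain ⟨u, v, rfl⟩ : ∃ u v, x = Sum.elim u v := ⟨x ∘ Sum.inl, x ∘ Sum.inr, by simp⟩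
  have hstar : star (Sum.elim u v) = Sum.elim (star u) (star v) := by
    ext (a | b) <;> simp
  rw [hstar, Matrix.fromBlocks_mulVec]
  simp only [Sum.elim_comp_inl, Sum.elim_comp_inr, Matrix.zero_mulVec, add_zero, zero_add,
    sumElim_dotProduct_sumElim]
  have hu0 := hA.posSemidef.dotProduct_mulVec_nonneg u
  have hv0 := hD.posSemidef.dotProduct_mulVec_nonneg v
  by_cases hu : u = 0
  · have hv : v ≠ 0 := by
      rintro rfl
      exact hx (by subst hu; ext (a | b) <;> rfl)
    exact add_pos_of_nonneg_of_pos hu0 (hD.dotProduct_mulVec_pos hv)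
  · exact add_pos_of_pos_of_nonneg (hA.dotProduct_mulVec_pos hu) hv0

theorem Matrix.PosDef.vPrincipal_det_pos {n : ℕ} {k : Fin n → ℕ}
    {K : Matrix ((i : Fin n) × Fin (k i)) ((i : Fin n) × Fin (k i)) ℝ} (hK : K.PosDef)
    (α : Finset (Fin n)) : 0 < (vPrincipal K α).det :=
  (hK.submatrix Subtype.val_injective).det_pos

/-- Blocks of lengths `k i + l i` split into blocks of lengths `k i` and blocks of lengths `l i`. -/
def sigmaFinAddEquiv {n : ℕ} (k l : Fin n → ℕ) :
    ((i : Fin n) × Fin (k i + l i)) ≃ ((i : Fin n) × Fin (k i)) ⊕ ((i : Fin n) × Fin (l i)) :=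
  (Equiv.sigmaCongrRight fun _ => finSumFinEquiv.symm).trans (Equiv.sigmaSumDistrib _ _)

/-- The direct sum of two block matrices, with corresponding blocks merged. -/
def blockSum {n : ℕ} {k l : Fin n → ℕ}
    (K : Matrix ((i : Fin n) × Fin (k i)) ((i : Fin n) × Fin (k i)) ℝ)
    (L : Matrix ((i : Fin n) × Fin (l i)) ((i : Fin n) × Fin (l i)) ℝ) :
    Matrix ((i : Fin n) × Fin (k i + l i)) ((i : Fin n) × Fin (k i + l i)) ℝ :=
  (Matrix.fromBlocks K 0 0 L).submatrix (sigmaFinAddEquiv k l) (sigmaFinAddEquiv k l)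

theorem vPrincipal_blockSum_det {n : ℕ} {k l : Fin n → ℕ}
    (K : Matrix ((i : Fin n) × Fin (k i)) ((i : Fin n) × Fin (k i)) ℝ)
    (L : Matrix ((i : Fin n) × Fin (l i)) ((i : Fin n) × Fin (l i)) ℝ) (α : Finset (Fin n)) :
    (vPrincipal (blockSum K L) α).det = (vPrincipal K α).det * (vPrincipal L α).det := by
  have hsplit (q : ((i : Fin n) × Fin (k i)) ⊕ ((i : Fin n) × Fin (l i))) :
      q.elim Sigma.fst Sigma.fst ∈ α ↔ ((sigmaFinAddEquiv k l).symm q).1 ∈ α := by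
    rcases q with q | q <;> rfl
  let e : {p : (i : Fin n) × Fin (k i + l i) // p.1 ∈ α} ≃
      {p : (i : Fin n) × Fin (k i) // p.1 ∈ α} ⊕ {p : (i : Fin n) × Fin (l i) // p.1 ∈ α} :=
    ((sigmaFinAddEquiv k l).symm.subtypeEquiv hsplit).symm.trans Equiv.subtypeSum
  rw [← Matrix.det_fromBlocks_zero₂₁ (vPrincipal K α) 0 (vPrincipal L α),
    ← Matrix.det_submatrix_equiv_self e.symm]
  congr 1
  ext (a | a) (b | b) <;> simp [e, vPrincipal, blockSum, Equiv.subtypeSum]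

theorem IsVGaussian.add {n : ℕ} {g h : Finset (Fin n) → ℝ} (hg : IsVGaussian n g)
    (hh : IsVGaussian n h) : IsVGaussian n (g + h) := by
  obtain ⟨k, hk, K, hK, hgK⟩ := hg
  obtain ⟨l, -, L, hL, hhL⟩ := hh
  refine ⟨fun i => k i + l i, fun i => Nat.add_pos_left (hk i) _, blockSum K L,
    (hK.fromBlocks_zero hL).submatrix (sigmaFinAddEquiv k l).injective, fun α => ?_⟩
  have hKα := hK.vPrincipal_det_pos α
  have hLα := hL.vPrincipal_det_pos α
  rw [Pi.add_apply, hgK, hhL, vPrincipal_blockSum_det, ← mul_add,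
    ← Real.logb_mul (by positivity) (by positivity), Finset.sum_add_distrib, pow_add]
  congr 2
  ring

theorem IsVGaussian.natCast_smul {n : ℕ} {g : Finset (Fin n) → ℝ} (hg : IsVGaussian n g) {p : ℕ}
    (hp : 0 < p) : IsVGaussian n ((p : ℝ) • g) := by
  induction p, hp using Nat.le_induction with
  | base => simpa using hg
  | succ p _ ih => simpa [add_smul] using ih.add hg

theorem smul_mem_Wscale {E : Type*} [AddCommMonoid E] [Module ℝ E] {S : Set E} {c : ℝ}
    (hc : 0 < c) {x : E} (hx : x ∈ Wscale S) : c • x ∈ Wscale S := by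
  obtain ⟨a, ha, g, hg, rfl⟩ := hx
  exact ⟨c * a, mul_pos hc ha, g, hg, smul_smul c a g⟩

/-- Positive reals are limits of quotients of positive natural numbers. -/
theorem mem_closure_natCast_div {t : ℝ} (ht : 0 < t) :
    t ∈ closure {r : ℝ | ∃ p q : ℕ, 0 < p ∧ 0 < q ∧ r = p / q} := by
  rw [Metric.mem_closure_iff]
  intro ε hε
  obtain ⟨r, htr, hrε⟩ := exists_rat_btwn (lt_add_of_pos_right t hε)
  have hr : 0 < r := by exact_mod_cast ht.trans htr
  refine ⟨r, ⟨r.num.toNat, r.den, by simpa using Rat.num_pos.2 hr, r.den_pos, ?_⟩, ?_⟩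
  · have hnum : ((r.num.toNat : ℤ) : ℝ) = r.num := by
      rw [Int.toNat_of_nonneg (Rat.num_pos.2 hr).le]
    rw [← Int.cast_natCast r.num.toNat, hnum, Rat.cast_def]
  · rw [Real.dist_eq, abs_sub_comm, abs_of_pos (by linarith)]
    linarith

section TopologicalCone

variable {E : Type*} [AddCommGroup E] [Module ℝ E] [TopologicalSpace E] [ContinuousAdd E]
  [ContinuousSMul ℝ E] {S : Set E}

theorem add_mem_closure_Wscale (hS : ∀ x ∈ S, ∀ y ∈ S, x + y ∈ S)
    (hS' : ∀ x ∈ S, ∀ p : ℕ, 0 < p → (p : ℝ) • x ∈ S) {x y : E} (hx : x ∈ Wscale S)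
    (hy : y ∈ Wscale S) : x + y ∈ closure (Wscale S) := by
  obtain ⟨a, ha, g, hg, rfl⟩ := hx
  obtain ⟨b, hb, h, hh, rfl⟩ := hy
  have hcont : Continuous fun t : ℝ => b • (t • g + h) := by fun_prop
  have key := map_mem_closure hcont (mem_closure_natCast_div (div_pos ha hb))
    (t := Wscale S) ?_
  · rwa [smul_add, smul_smul, mul_div_cancel₀ _ hb.ne'] at key
  · rintro _ ⟨p, q, hp, hq, rfl⟩
    have hq' : (0 : ℝ) < q := by exact_mod_cast hq
    refine smul_mem_Wscale hb ⟨(q : ℝ)⁻¹, inv_pos.2 hq', (p : ℝ) • g + (q : ℝ) • h,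
      hS _ (hS' g hg p hp) _ (hS' h hh q hq), ?_⟩
    rw [smul_add, smul_smul, smul_smul, inv_mul_cancel₀ hq'.ne', one_smul, div_eq_inv_mul]

theorem isClosedConvexCone_closure_Wscale (hS : ∀ x ∈ S, ∀ y ∈ S, x + y ∈ S)
    (hS' : ∀ x ∈ S, ∀ p : ℕ, 0 < p → (p : ℝ) • x ∈ S) :
    IsClosedConvexCone (closure (Wscale S)) := by
  have hsmul (c : ℝ) (hc : 0 < c) (x : E) (hx : x ∈ closure (Wscale S)) :
      c • x ∈ closure (Wscale S) :=
    map_mem_closure (continuous_const_smul c) hx fun _ hy => smul_mem_Wscale hc hy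
  have hadd (x : E) (hx : x ∈ closure (Wscale S)) (y : E) (hy : y ∈ closure (Wscale S)) :
      x + y ∈ closure (Wscale S) := by
    rw [← closure_closure (s := Wscale S)]
    exact map_mem_closure₂ continuous_add hx hy fun a ha b hb =>
      add_mem_closure_Wscale hS hS' ha hb
  exact ⟨isClosed_closure, convex_iff_forall_pos.2 fun x hx y hy a b ha hb _ =>
    hadd _ (hsmul a ha x hx) _ (hsmul b hb y hy), hsmul⟩

theorem closure_Wscale_eq_ccc (hS : ∀ x ∈ S, ∀ y ∈ S, x + y ∈ S)
    (hS' : ∀ x ∈ S, ∀ p : ℕ, 0 < p → (p : ℝ) • x ∈ S) : closure (Wscale S) = ccc S := by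
  apply Set.Subset.antisymm
  · rintro x hx C ⟨⟨hclosed, -, hcone⟩, hSC⟩
    refine closure_minimal ?_ hclosed hx
    rintro _ ⟨c, hc, g, hg, rfl⟩
    exact hcone c hc g (hSC hg)
  · exact Set.sInter_subset_of_mem ⟨isClosedConvexCone_closure_Wscale hS hS',
      fun g hg => subset_closure ⟨1, one_pos, g, hg, (one_smul ℝ g).symm⟩⟩

end TopologicalCone

/-- `W̄(Υ_{v,n}) = con(Υ_{v,n})`: the closure of the set of positive
scalar multiples of v-Gaussian functions is the closed convex cone they generate. -/
theorem stmt10 (n : ℕ) :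
    closure (Wscale {g : Finset (Fin n) → ℝ | IsVGaussian n g}) =
      ccc {g : Finset (Fin n) → ℝ | IsVGaussian n g} := by
  exact closure_Wscale_eq_ccc (fun _ hg _ hh => IsVGaussian.add hg hh)
    fun _ hg _ hp => IsVGaussian.natCast_smul hg hp

end
end
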